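/- arXiv:1506.08742 — 2 statements merged into one kernel-verified Lean document; each statement's English description precedes it below -/
import Mathlib

section
/- Nonnegativity of the single-level transition operators: let n ≥ 1. If ψ(x) = p_0 + p_1·x with real p_0 > p_1 ≥ 0, or if ψ(x) = e^{γ(x−1)} with γ ≥ 0, then det[⟨J_{μ̃_i,α_n}, J_{λ̃_j,α_n}·ψ⟩_{α_n}]_{i,j=1}^{r_n} ≥ 0 for all μ, λ ∈ 𝕁_n (equivalently, all entries T^ψ_n(μ,λ) are nonnegative). -/
open MeasureTheory Real

/-- Chebyshev polynomials of the second (`α = 1/2`) and third (`α = -1/2`) kind. -/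
noncomputable def chebJ (α : ℝ) : ℕ → ℝ → ℝ
  | 0, _ => 1
  | 1, x => if α = 1 / 2 then 2 * x else 2 * x - 1
  | n + 2, x => 2 * x * chebJ α (n + 1) x - chebJ α n x

/-- The normalized inner product `⟨f,g⟩_α`. -/
noncomputable def innerJ (α : ℝ) (f g : ℝ → ℝ) : ℝ :=
  (2 : ℝ) ^ (α + 1 / 2) / Real.pi *
    ∫ x in (-1 : ℝ)..1, f x * g x * (1 - x) ^ α * (1 + x) ^ ((1 : ℝ) / 2)

/-- `r_n = ⌊(n+1)/2⌋`. -/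
def rr (n : ℕ) : ℕ := (n + 1) / 2

/-- `α_n = 1/2` if `n` even, `-1/2` if `n` odd. -/
noncomputable def alph (n : ℕ) : ℝ := if Even n then 1 / 2 else -(1 / 2)

/-- A doubly infinite matrix all of whose minors are nonnegative. -/
def IsTotallyNonneg (M : ℕ → ℕ → ℝ) : Prop :=
  ∀ (r : ℕ) (I J : Fin r → ℕ), StrictMono I → StrictMono J →
    0 ≤ (Matrix.of fun i j => M (I i) (J j)).det

namespace IsTotallyNonneg

lemma det_nonneg_of_monotone {M : ℕ → ℕ → ℝ} (hM : IsTotallyNonneg M) {r : ℕ} {I J : Fin r → ℕ}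
    (hI : StrictMono I) (hJ : Monotone J) : 0 ≤ (Matrix.of fun i j => M (I i) (J j)).det := by
  by_cases hinj : Function.Injective J
  · exact hM r I J hI (hJ.strictMono_of_injective hinj)
  · rw [Function.not_injective_iff] at hinj
    obtain ⟨i, j, hij, hne⟩ := hinj
    exact (Matrix.det_zero_of_column_eq hne fun k => by simp [hij]).ge

/-- Total nonnegativity is preserved when every column is replaced by a nonnegative combination
of two columns, as long as the chosen columns move monotonically. -/
lemma column_combination {M : ℕ → ℕ → ℝ} (hM : IsTotallyNonneg M) {a b : ℕ → ℝ} {f g : ℕ → ℕ}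
    (ha : ∀ l, 0 ≤ a l) (hb : ∀ l, 0 ≤ b l)
    (hfg : ∀ l l', l < l' → max (f l) (g l) ≤ min (f l') (g l')) :
    IsTotallyNonneg fun k l => a l * M k (f l) + b l * M k (g l) := by
  intro r I J hI hJ
  have h : (Matrix.of fun i j => a (J j) * M (I i) (f (J j)) + b (J j) * M (I i) (g (J j))).det =
      Matrix.detRowAlternating
        ((fun j i => a (J j) * M (I i) (f (J j))) + fun j i => b (J j) * M (I i) (g (J j))) := by
    rw [← Matrix.det_transpose]
    rfl
  rw [h, AlternatingMap.map_add_univ]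
  refine Finset.sum_nonneg fun s _ => ?_
  set c : Fin r → ℝ := fun j => if j ∈ s then a (J j) else b (J j) with hc
  set K : Fin r → ℕ := fun j => if j ∈ s then f (J j) else g (J j) with hK
  have hs : s.piecewise (fun j i => a (J j) * M (I i) (f (J j)))
      (fun j i => b (J j) * M (I i) (g (J j))) = fun j => c j • fun i => M (I i) (K j) := by
    funext j i
    by_cases hj : j ∈ s <;> simp [hc, hK, hj]
  have hKm : Monotone K := by
    intro j j' hjj
    rcases hjj.eq_or_lt with rfl | hlt
    · exact le_rfl
    · have := hfg _ _ (hJ hlt)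
      simp only [hK]
      split_ifs <;> omega
  rw [hs]
  erw [MultilinearMap.map_smul_univ]
  refine mul_nonneg (Finset.prod_nonneg fun j _ => ?_) ?_
  · simp only [hc]
    split_ifs
    exacts [ha _, hb _]
  · have := hM.det_nonneg_of_monotone hI hKm
    rw [← Matrix.det_transpose] at this
    exact this

lemma of_tendsto {M : ℕ → ℕ → ℕ → ℝ} {L : ℕ → ℕ → ℝ}
    (hM : ∀ᶠ N in Filter.atTop, IsTotallyNonneg (M N))
    (hL : ∀ k l, Filter.Tendsto (fun N => M N k l) Filter.atTop (nhds (L k l))) :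
    IsTotallyNonneg L := by
  intro r I J hI hJ
  have hdet : Continuous fun A : Matrix (Fin r) (Fin r) ℝ => A.det := continuous_id.matrix_det
  have h : Filter.Tendsto (fun N => Matrix.of fun i j => M N (I i) (J j)) Filter.atTop
      (nhds (Matrix.of fun i j => L (I i) (J j))) :=
    tendsto_pi_nhds.2 fun i => tendsto_pi_nhds.2 fun j => hL _ _
  exact ge_of_tendsto ((hdet.tendsto _).comp h) (hM.mono fun N hN => hN r I J hI hJ)

end IsTotallyNonneg

lemma isTotallyNonneg_one : IsTotallyNonneg fun k l => if k = l then 1 else 0 := by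
  intro r I J hI hJ
  by_cases h : Set.range I ⊆ Set.range J
  · choose σ hσ using fun i => h (Set.mem_range_self i)
    have hσm : StrictMono σ := fun i j hij => hJ.lt_iff_lt.1 (by rw [hσ, hσ]; exact hI hij)
    have hσid : σ = id := by
      have := Subsingleton.elim (hσm.orderIsoOfSurjective σ
        (Finite.surjective_of_injective hσm.injective)) (OrderIso.refl _)
      funext i
      exact congrArg (fun e : Fin r ≃o Fin r => e i) this
    have hIJ : I = J := by
      funext i
      rw [← hσ i, hσid, id]
    subst hIJ
    have : (Matrix.of fun i j => if I i = I j then (1 : ℝ) else 0) = 1 := by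
      ext i j
      simp [Matrix.one_apply, hI.injective.eq_iff]
    rw [this, Matrix.det_one]
    exact zero_le_one
  · obtain ⟨_, ⟨i, rfl⟩, hi⟩ := Set.not_subset.1 h
    refine (Matrix.det_eq_zero_of_row_eq_zero i fun j => ?_).ge
    have : I i ≠ J j := fun e => hi ⟨j, e.symm⟩
    simp [this]

lemma continuous_chebJ (α : ℝ) : ∀ k, Continuous (chebJ α k)
  | 0 => by
    rw [show chebJ α 0 = fun _ => 1 from funext fun x => by rw [chebJ]]
    fun_prop
  | 1 => by
    rw [show chebJ α 1 = fun x => if α = 1 / 2 then 2 * x else 2 * x - 1 from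
      funext fun x => by rw [chebJ]]
    split_ifs <;> fun_prop
  | k + 2 => by
    have h1 := continuous_chebJ α (k + 1)
    have h0 := continuous_chebJ α k
    rw [show chebJ α (k + 2) = fun x => 2 * x * chebJ α (k + 1) x - chebJ α k x from
      funext fun x => by rw [chebJ]]
    fun_prop

/-- The weight of `innerJ α` after the substitution `x = cos θ`. -/
noncomputable def angularWeight (α θ : ℝ) : ℝ :=
  if α = 1 / 2 then 2 / π * sin θ ^ 2 else 1 / π * (1 + cos θ)

lemma continuous_angularWeight (α : ℝ) : Continuous (angularWeight α) := by
  unfold angularWeight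
  split_ifs <;> fun_prop

lemma innerJ_eq_integral_angularWeight {α : ℝ} (hα : α = 1 / 2 ∨ α = -(1 / 2)) (f g : ℝ → ℝ) :
    innerJ α f g = ∫ θ in 0..π, f (cos θ) * g (cos θ) * angularWeight α θ := by
  have key : ∀ h : ℝ → ℝ, ∫ x in (-1 : ℝ)..1, h x * √(1 - x ^ 2)⁻¹ = ∫ θ in 0..π, h (cos θ) :=
    fun h => by
      rw [← Polynomial.Chebyshev.integral_measureT,
        Polynomial.Chebyshev.integral_measureT_eq_integral_cos]
  have weight : ∀ x ∈ Set.Ioo (-1 : ℝ) 1, (1 - x) ^ α * (1 + x) ^ ((1 : ℝ) / 2) =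
      (if α = 1 / 2 then 1 - x ^ 2 else 1 + x) * √(1 - x ^ 2)⁻¹ := by
    intro x hx
    have h1 : 0 < 1 - x := by linarith [hx.2]
    have h2 : 0 < 1 + x := by linarith [hx.1]
    have h1' := Real.sqrt_pos.2 h1
    have h2' := Real.sqrt_pos.2 h2
    have e : √(1 - x ^ 2)⁻¹ = (√(1 - x) * √(1 + x))⁻¹ := by
      rw [Real.sqrt_inv, ← Real.sqrt_mul h1.le]
      ring_nf
    have s1 := Real.mul_self_sqrt h1.le
    have s2 := Real.mul_self_sqrt h2.le
    rw [e, ← Real.sqrt_eq_rpow]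
    rcases hα with rfl | rfl
    · rw [← Real.sqrt_eq_rpow, if_pos rfl, eq_mul_inv_iff_mul_eq₀ (by positivity)]
      linear_combination (1 + x) * s1 + √(1 - x) * √(1 - x) * s2
    · rw [Real.rpow_neg h1.le, ← Real.sqrt_eq_rpow, if_neg (by norm_num),
        eq_mul_inv_iff_mul_eq₀ (by positivity)]
      field_simp
      linear_combination s2
  have hint : ∫ x in (-1 : ℝ)..1, f x * g x * (1 - x) ^ α * (1 + x) ^ ((1 : ℝ) / 2) =
      ∫ x in (-1 : ℝ)..1, f x * g x * (if α = 1 / 2 then 1 - x ^ 2 else 1 + x) *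
        √(1 - x ^ 2)⁻¹ := by
    refine intervalIntegral.integral_congr_ae ?_
    have : ∀ᵐ x : ℝ, x ≠ 1 := by simp [ae_iff]
    filter_upwards [this] with x hx1 hx
    rw [Set.uIoc_of_le (by norm_num)] at hx
    rw [mul_assoc, weight x ⟨hx.1, lt_of_le_of_ne hx.2 hx1⟩, mul_assoc, mul_assoc, mul_assoc]
  rw [innerJ, hint, key, ← intervalIntegral.integral_const_mul]
  congr 1
  funext θ
  rcases hα with rfl | rfl
  · rw [angularWeight, if_pos rfl, if_pos rfl, Real.sin_sq]
    norm_num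
    ring
  · rw [angularWeight, if_neg (by norm_num), if_neg (by norm_num)]
    norm_num
    ring

lemma integral_cos_int_mul (m : ℤ) :
    ∫ θ in 0..π, cos (m * θ) = if m = 0 then π else 0 := by
  split_ifs with h
  · simp [h]
  · have := Polynomial.Chebyshev.integral_eval_T_real_measureT_of_ne_zero h
    rw [Polynomial.Chebyshev.integral_measureT_eq_integral_cos] at this
    simpa only [Polynomial.Chebyshev.T_real_cos] using this

lemma chebJ_half_cos (θ : ℝ) : ∀ k : ℕ, chebJ (1 / 2) k (cos θ) * sin θ = sin ((k + 1) * θ)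
  | 0 => by simp [chebJ]
  | 1 => by
    rw [chebJ, if_pos rfl]
    push_cast
    rw [show ((1 : ℝ) + 1) * θ = 2 * θ by ring, sin_two_mul]
    ring
  | k + 2 => by
    have h1 := chebJ_half_cos θ (k + 1)
    have h0 := chebJ_half_cos θ k
    rw [chebJ, sub_mul, mul_assoc, h1, h0]
    push_cast
    rw [show ((k : ℝ) + 2 + 1) * θ = (k + 1 + 1) * θ + θ by ring,
      show ((k : ℝ) + 1) * θ = (k + 1 + 1) * θ - θ by ring, sin_add, sin_sub]
    ring

lemma chebJ_neg_half_cos (θ : ℝ) :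
    ∀ k : ℕ, chebJ (-(1 / 2)) k (cos θ) * cos (θ / 2) = cos ((k + 1 / 2) * θ)
  | 0 => by
    simp only [chebJ]
    push_cast
    ring_nf
  | 1 => by
    rw [chebJ, if_neg (by norm_num)]
    push_cast
    have hc : cos θ = 2 * cos (θ / 2) ^ 2 - 1 := by
      rw [← cos_two_mul]
      ring_nf
    rw [show ((1 : ℝ) + 1 / 2) * θ = 3 * (θ / 2) by ring, cos_three_mul, hc]
    ring
  | k + 2 => by
    have h1 := chebJ_neg_half_cos θ (k + 1)
    have h0 := chebJ_neg_half_cos θ k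
    rw [chebJ, sub_mul, mul_assoc, h1, h0]
    push_cast
    rw [show ((k : ℝ) + 2 + 1 / 2) * θ = (k + 1 + 1 / 2) * θ + θ by ring,
      show ((k : ℝ) + 1 / 2) * θ = (k + 1 + 1 / 2) * θ - θ by ring, cos_add, cos_sub]
    ring

lemma innerJ_chebJ_chebJ {α : ℝ} (hα : α = 1 / 2 ∨ α = -(1 / 2)) (k l : ℕ) :
    innerJ α (chebJ α k) (chebJ α l) = if k = l then 1 else 0 := by
  have hcos : ∀ m : ℤ, IntervalIntegrable (fun θ : ℝ => cos (m * θ)) volume 0 π := fun m =>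
    (by fun_prop : Continuous fun θ : ℝ => cos (m * θ)).intervalIntegrable _ _
  have hkl : (k : ℤ) - l = 0 ↔ k = l := by
    rw [sub_eq_zero, Nat.cast_inj]
  have hpi := Real.pi_ne_zero
  rw [innerJ_eq_integral_angularWeight hα]
  rcases hα with rfl | rfl
  · have h : ∀ θ : ℝ, chebJ (1 / 2) k (cos θ) * chebJ (1 / 2) l (cos θ) *
        angularWeight (1 / 2) θ =
        1 / π * (cos (((k - l : ℤ) : ℝ) * θ) - cos (((k + l + 2 : ℤ) : ℝ) * θ)) := by
      intro θ
      rw [angularWeight, if_pos rfl]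
      push_cast
      rw [show ((k : ℝ) - l) * θ = (k + 1) * θ - (l + 1) * θ by ring,
        show ((k : ℝ) + l + 2) * θ = (k + 1) * θ + (l + 1) * θ by ring, cos_add, cos_sub,
        ← chebJ_half_cos θ k, ← chebJ_half_cos θ l]
      ring
    simp_rw [h]
    rw [intervalIntegral.integral_const_mul, intervalIntegral.integral_sub (hcos _) (hcos _),
      integral_cos_int_mul, integral_cos_int_mul, if_neg (by omega : ¬(k + l + 2 : ℤ) = 0)]
    simp only [hkl]
    split_ifs <;> simp [hpi]
  · have h : ∀ θ : ℝ, chebJ (-(1 / 2)) k (cos θ) * chebJ (-(1 / 2)) l (cos θ) *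
        angularWeight (-(1 / 2)) θ =
        1 / π * (cos (((k - l : ℤ) : ℝ) * θ) + cos (((k + l + 1 : ℤ) : ℝ) * θ)) := by
      intro θ
      have hc : 1 + cos θ = 2 * cos (θ / 2) ^ 2 := by
        have := cos_two_mul (θ / 2)
        rw [show 2 * (θ / 2) = θ by ring] at this
        rw [this]
        ring
      rw [angularWeight, if_neg (by norm_num), hc]
      push_cast
      rw [show ((k : ℝ) - l) * θ = (k + 1 / 2) * θ - (l + 1 / 2) * θ by ring,
        show ((k : ℝ) + l + 1) * θ = (k + 1 / 2) * θ + (l + 1 / 2) * θ by ring, cos_add, cos_sub,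
        ← chebJ_neg_half_cos θ k, ← chebJ_neg_half_cos θ l]
      ring
    simp_rw [h]
    rw [intervalIntegral.integral_const_mul, intervalIntegral.integral_add (hcos _) (hcos _),
      integral_cos_int_mul, integral_cos_int_mul, if_neg (by omega : ¬(k + l + 1 : ℤ) = 0)]
    simp only [hkl]
    split_ifs <;> simp [hpi]

/-- The matrix of multiplication by `ψ` in the basis `chebJ α`. -/
noncomputable def multMatrix (α : ℝ) (ψ : ℝ → ℝ) (k l : ℕ) : ℝ :=
  innerJ α (chebJ α k) fun x => chebJ α l x * ψ x

section multMatrix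

variable {α : ℝ} {ψ : ℝ → ℝ}

lemma innerJ_linear_combination (hα : α = 1 / 2 ∨ α = -(1 / 2)) {f g h : ℝ → ℝ}
    (hf : Continuous f) (hg : Continuous g) (hh : Continuous h) (c d : ℝ) :
    innerJ α f (fun x => c * g x + d * h x) = c * innerJ α f g + d * innerJ α f h := by
  have hw := continuous_angularWeight α
  simp only [innerJ_eq_integral_angularWeight hα]
  rw [← intervalIntegral.integral_const_mul, ← intervalIntegral.integral_const_mul,
    ← intervalIntegral.integral_add
      (Continuous.intervalIntegrable (by fun_prop) _ _)
      (Continuous.intervalIntegrable (by fun_prop) _ _)]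
  congr 1
  funext θ
  ring

lemma multMatrix_mul_affine_succ (hα : α = 1 / 2 ∨ α = -(1 / 2)) (hψ : Continuous ψ)
    (p₀ p₁ : ℝ) (k l : ℕ) :
    multMatrix α (fun x => ψ x * (p₀ + p₁ * x)) k (l + 1) =
      p₀ * multMatrix α ψ k (l + 1) +
        p₁ / 2 * (multMatrix α ψ k (l + 2) + multMatrix α ψ k l) := by
  have hJ := continuous_chebJ α
  have h : (fun x => chebJ α (l + 1) x * (ψ x * (p₀ + p₁ * x))) = fun x =>
      p₀ * (chebJ α (l + 1) x * ψ x) + p₁ / 2 *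
        (1 * (chebJ α (l + 2) x * ψ x) + 1 * (chebJ α l x * ψ x)) := by
    funext x
    rw [chebJ]
    ring
  have c : ∀ m, Continuous fun x => chebJ α m x * ψ x := fun m => (hJ m).mul hψ
  rw [multMatrix, h, innerJ_linear_combination hα (hJ k) (c _)
    (h := fun x => 1 * (chebJ α (l + 2) x * ψ x) + 1 * (chebJ α l x * ψ x)) (by fun_prop),
    innerJ_linear_combination hα (hJ k) (c _) (c _), one_mul, one_mul]
  rfl

lemma multMatrix_mul_affine_zero (hα : α = 1 / 2 ∨ α = -(1 / 2)) (hψ : Continuous ψ)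
    (p₀ p₁ : ℝ) (k : ℕ) :
    multMatrix α (fun x => ψ x * (p₀ + p₁ * x)) k 0 =
      (p₀ + if α = 1 / 2 then 0 else p₁ / 2) * multMatrix α ψ k 0 +
        p₁ / 2 * multMatrix α ψ k 1 := by
  have hJ := continuous_chebJ α
  have h : (fun x => chebJ α 0 x * (ψ x * (p₀ + p₁ * x))) = fun x =>
      (p₀ + if α = 1 / 2 then 0 else p₁ / 2) * (chebJ α 0 x * ψ x) +
        p₁ / 2 * (chebJ α 1 x * ψ x) := by
    funext x
    simp only [chebJ]
    split_ifs <;> ring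
  have c : ∀ m, Continuous fun x => chebJ α m x * ψ x := fun m => (hJ m).mul hψ
  rw [multMatrix, h, innerJ_linear_combination hα (hJ k) (c _) (c _)]
  rfl

/-- Multiplication by an affine function factors into two nonnegative bidiagonal matrices. -/
lemma IsTotallyNonneg.multMatrix_mul_affine (hα : α = 1 / 2 ∨ α = -(1 / 2)) (hψ : Continuous ψ)
    (hT : IsTotallyNonneg (multMatrix α ψ)) {p₀ p₁ : ℝ} (h₁ : 0 ≤ p₁) (h₀ : p₁ ≤ p₀) :
    IsTotallyNonneg (multMatrix α fun x => ψ x * (p₀ + p₁ * x)) := by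
  set s := √(p₀ + p₁) with hs
  set t := √(p₀ - p₁) with ht
  have hss : s ^ 2 = p₀ + p₁ := Real.sq_sqrt (by linarith)
  have htt : t ^ 2 = p₀ - p₁ := Real.sq_sqrt (by linarith)
  have hts : t ≤ s := Real.sqrt_le_sqrt (by linarith)
  have ht0 : 0 ≤ t := Real.sqrt_nonneg _
  obtain ⟨a, ha⟩ : ∃ a, a = (s + t) / 2 := ⟨_, rfl⟩
  obtain ⟨b, hb⟩ : ∃ b, b = (s - t) / 2 := ⟨_, rfl⟩
  have ha0 : 0 ≤ a := by rw [ha]; linarith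
  have hb0 : 0 ≤ b := by rw [hb]; linarith
  have hab : a * b = p₁ / 2 := by rw [ha, hb]; linear_combination (hss - htt) / 4
  have hab2 : a ^ 2 + b ^ 2 = p₀ := by rw [ha, hb]; linear_combination (hss + htt) / 2
  obtain ⟨e, he⟩ : ∃ e : ℝ, e = if α = 1 / 2 then 0 else p₁ / 2 := ⟨_, rfl⟩
  have he0 : 0 ≤ e := by rw [he]; split_ifs <;> linarith
  have hdd : √(a ^ 2 + e) ^ 2 = a ^ 2 + e := Real.sq_sqrt (by positivity)
  set d : ℕ → ℝ := fun l => if l = 0 then √(a ^ 2 + e) else a with hd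
  have hd0 : ∀ l, 0 ≤ d l := fun l => by
    simp only [hd]
    split_ifs
    exacts [Real.sqrt_nonneg _, ha0]
  have down := hT.column_combination (a := d) (b := fun l => if l = 0 then 0 else b)
    (f := id) (g := fun l => l - 1) hd0 (fun l => by split_ifs <;> simp [hb0])
    (fun l l' h => by simp only [id]; omega)
  have up := down.column_combination (a := d) (b := fun _ => b) (f := id) (g := fun l => l + 1)
    hd0 (fun _ => hb0) (fun l l' h => by simp only [id]; omega)
  convert up using 3 with k l
  cases l with
  | zero =>
    rw [multMatrix_mul_affine_zero hα hψ, ← he]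
    simp only [hd, id, if_true, zero_add, one_ne_zero, if_false, Nat.sub_self]
    linear_combination (-multMatrix α ψ k 0) * (hdd + hab2) - multMatrix α ψ k 1 * hab
  | succ l =>
    rw [multMatrix_mul_affine_succ hα hψ]
    simp only [hd, id, Nat.succ_ne_zero, if_false, Nat.add_sub_cancel]
    linear_combination (-multMatrix α ψ k (l + 1)) * hab2 -
      (multMatrix α ψ k (l + 2) + multMatrix α ψ k l) * hab

lemma isTotallyNonneg_multMatrix_affine_pow (hα : α = 1 / 2 ∨ α = -(1 / 2)) {p₀ p₁ : ℝ}
    (h₁ : 0 ≤ p₁) (h₀ : p₁ ≤ p₀) (N : ℕ) :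
    IsTotallyNonneg (multMatrix α fun x => (p₀ + p₁ * x) ^ N) := by
  induction N with
  | zero =>
    convert isTotallyNonneg_one using 3 with k l
    simp only [multMatrix, pow_zero, mul_one]
    exact innerJ_chebJ_chebJ hα k l
  | succ N ih =>
    simp only [pow_succ]
    exact ih.multMatrix_mul_affine hα (by fun_prop) h₁ h₀

lemma isTotallyNonneg_multMatrix_exp (hα : α = 1 / 2 ∨ α = -(1 / 2)) {γ : ℝ} (hγ : 0 ≤ γ) :
    IsTotallyNonneg (multMatrix α fun x => exp (γ * (x - 1))) := by
  have hJ := continuous_chebJ α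
  have hw := continuous_angularWeight α
  have hlarge : ∀ᶠ N : ℕ in Filter.atTop, 0 < (N : ℝ) ∧ 2 * γ ≤ N :=
    ((Filter.eventually_gt_atTop 0).and (Filter.eventually_ge_atTop (2 * γ))).filter_mono
      tendsto_natCast_atTop_atTop |>.mono fun _ h => h
  refine IsTotallyNonneg.of_tendsto
    (M := fun N => multMatrix α fun x => ((1 - γ / N) + γ / N * x) ^ N) ?_ fun k l => ?_
  · filter_upwards [hlarge] with N hN
    refine isTotallyNonneg_multMatrix_affine_pow hα (div_nonneg hγ hN.1.le) ?_ N
    have : 2 * γ / N ≤ 1 := (div_le_one hN.1).2 hN.2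
    have e : 2 * γ / N = γ / N + γ / N := by ring
    linarith
  · simp only [multMatrix, innerJ_eq_integral_angularWeight hα]
    refine intervalIntegral.tendsto_integral_filter_of_dominated_convergence
      (fun θ => |chebJ α k (cos θ) * chebJ α l (cos θ) * angularWeight α θ|)
      (Filter.Eventually.of_forall fun N => ?_) ?_ ?_ ?_
    · exact (Continuous.aestronglyMeasurable (by fun_prop))
    · filter_upwards [hlarge] with N hN
      refine Filter.Eventually.of_forall fun θ _ => ?_
      have hd : 0 ≤ γ / N := div_nonneg hγ hN.1.le
      have h2 : 2 * γ / N ≤ 1 := (div_le_one hN.1).2 hN.2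
      have e : 2 * γ / N = γ / N + γ / N := by ring
      have hb : |(1 - γ / N) + γ / N * cos θ| ≤ 1 := by
        rw [abs_le]
        constructor <;> nlinarith [cos_le_one θ, neg_one_le_cos θ]
      have hp : |((1 - γ / N) + γ / N * cos θ) ^ N| ≤ 1 := by
        rw [abs_pow]
        exact pow_le_one₀ (abs_nonneg _) hb
      rw [Real.norm_eq_abs, show chebJ α k (cos θ) * (chebJ α l (cos θ) *
        ((1 - γ / N) + γ / N * cos θ) ^ N) * angularWeight α θ =
        chebJ α k (cos θ) * chebJ α l (cos θ) * angularWeight α θ *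
        ((1 - γ / N) + γ / N * cos θ) ^ N by ring, abs_mul]
      exact mul_le_of_le_one_right (abs_nonneg _) hp
    · exact Continuous.intervalIntegrable (by fun_prop) _ _
    · refine Filter.Eventually.of_forall fun θ _ => ?_
      have h := Real.tendsto_one_add_div_pow_exp (γ * (cos θ - 1))
      have h' : Filter.Tendsto (fun N : ℕ => ((1 - γ / N) + γ / N * cos θ) ^ N) Filter.atTop
          (nhds (exp (γ * (cos θ - 1)))) := by
        convert h using 3 with N
        ring
      exact (h'.const_mul _ |>.const_mul _).mul_const _

end multMatrix

/-- Nonnegativity of the single-level transition determinants for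
`ψ(x) = p₀ + p₁x` with `p₀ > p₁ ≥ 0`, or `ψ(x) = e^{γ(x−1)}` with `γ ≥ 0`. -/
theorem transition_nonneg (n : ℕ) (hn : 1 ≤ n) (ψ : ℝ → ℝ)
    (hψ : (∃ p₀ p₁ : ℝ, 0 ≤ p₁ ∧ p₁ < p₀ ∧ ψ = fun x => p₀ + p₁ * x) ∨
          (∃ γ : ℝ, 0 ≤ γ ∧ ψ = fun x => Real.exp (γ * (x - 1))))
    (μ lam : Fin (rr n) → ℕ) (hμ : Antitone μ) (hlam : Antitone lam) :
    0 ≤ Matrix.det (Matrix.of fun i j : Fin (rr n) =>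
        innerJ (alph n) (chebJ (alph n) (μ i + (rr n - 1 - (i : ℕ))))
          (fun x => chebJ (alph n) (lam j + (rr n - 1 - (j : ℕ))) x * ψ x)) := by
  have hα : alph n = 1 / 2 ∨ alph n = -(1 / 2) := by
    unfold alph
    split_ifs <;> simp
  have hT : IsTotallyNonneg (multMatrix (alph n) ψ) := by
    rcases hψ with ⟨p₀, p₁, h₁, h₀, rfl⟩ | ⟨γ, hγ, rfl⟩
    · simpa using isTotallyNonneg_multMatrix_affine_pow hα h₁ h₀.le 1
    · exact isTotallyNonneg_multMatrix_exp hα hγ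
  have hmono : ∀ ν : Fin (rr n) → ℕ, Antitone ν →
      StrictMono fun i : Fin (rr n) => ν i.rev + (rr n - 1 - (i.rev : ℕ)) := by
    intro ν hν i j hij
    have h1 : ν i.rev ≤ ν j.rev := hν (Fin.rev_le_rev.2 hij.le)
    have h2 : (i : ℕ) < j := hij
    have h3 := j.isLt
    simp only [Fin.val_rev]
    omega
  have h := hT _ _ _ (hmono μ hμ) (hmono lam hlam)
  rw [← Matrix.det_submatrix_equiv_self Fin.revPerm]
  exact h
end

section
/- Intertwining relation between transition and cotransition operators: let n ≥ 1 and let ψ be infinitely differentiable on a neighborhood of [−1,1] with ψ(1) = 1. Define the cotransition operator T^{n+1}_n(μ,λ) := (dim_n λ / dim_{n+1} μ)·1_{(λ ≺ μ)} for μ ∈ 𝕁_{n+1}, λ ∈ 𝕁_n. Then for all μ ∈ 𝕁_{n+1} and λ ∈ 𝕁_n, both sums below converge absolutely and ∑_{z ∈ 𝕁_n} T^{n+1}_n(μ,z)·T^ψ_n(z,λ) = ∑_{z ∈ 𝕁_{n+1}} T^ψ_{n+1}(μ,z)·T^{n+1}_n(z,λ). -/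
open MeasureTheory Real Classical

/-- `dim_n λ`. -/
noncomputable def dimSp (n : ℕ) (lam : Fin (rr n) → ℕ) : ℝ :=
  let r : ℕ := rr n
  let L : Fin r → ℝ := fun i => (lam i : ℝ) + (r : ℝ) - (i : ℕ)
  let M : Fin r → ℝ := fun i => (r : ℝ) - (i : ℕ)
  if Even n then
    (∏ i : Fin r, ∏ j ∈ Finset.Ioi i, ((L i) ^ 2 - (L j) ^ 2) / ((M i) ^ 2 - (M j) ^ 2)) *
      ∏ i : Fin r, L i / M i
  else
    ∏ i : Fin r, ∏ j ∈ Finset.Ioi i,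
      ((L i - 1 / 2) ^ 2 - (L j - 1 / 2) ^ 2) / ((M i - 1 / 2) ^ 2 - (M j - 1 / 2) ^ 2)

/-- The single-level transition operator
`T^ψ_n(μ,λ) := det[⟨J_{μ̃_i,α_n}, J_{λ̃_j,α_n}·ψ⟩_{α_n}]·(dim_n λ / dim_n μ)`. -/
noncomputable def Tpsi (ψ : ℝ → ℝ) (n : ℕ) (μ lam : Fin (rr n) → ℕ) : ℝ :=
  Matrix.det (Matrix.of fun i j : Fin (rr n) =>
    innerJ (alph n) (chebJ (alph n) (μ i + (rr n - 1 - (i : ℕ))))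
      (fun x => chebJ (alph n) (lam j + (rr n - 1 - (j : ℕ))) x * ψ x)) *
  (dimSp n lam / dimSp n μ)

/-- Interlacement `λ ≺ μ`: `μ_1 ≥ λ_1 ≥ μ_2 ≥ λ_2 ≥ …`, with overflowing indices
read as `0`. -/
def interlaceN {r R : ℕ} (l : Fin r → ℕ) (m : Fin R → ℕ) : Prop :=
  (∀ i : Fin r, ∀ h : (i : ℕ) < R, l i ≤ m ⟨i, h⟩) ∧
  (∀ i : Fin r, ∀ h : (i : ℕ) + 1 < R, m ⟨(i : ℕ) + 1, h⟩ ≤ l i)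

/-- The cotransition operator `T^{n+1}_n(μ,λ) := (dim_n λ / dim_{n+1} μ)·1_{λ≺μ}`. -/
noncomputable def coT (n : ℕ) (μ : Fin (rr (n + 1)) → ℕ) (lam : Fin (rr n) → ℕ) : ℝ :=
  (dimSp n lam / dimSp (n + 1) μ) * (if interlaceN lam μ then 1 else 0)

/-! ### Summation over boxes of multi-indices -/

theorem hasSum_pi_prod {r : ℕ} (f : Fin r → ℕ → ℝ) (hf : ∀ j, Summable (f j)) :
    HasSum (fun z : Fin r → ℕ => ∏ j, f j (z j)) (∏ j, ∑' l, f j l) := by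
  induction r with
  | zero => simp
  | succ r ih =>
    have ih' := ih (fun j => f j.succ) (fun j => hf j.succ)
    rw [← (Fin.consEquiv (fun _ : Fin (r + 1) => ℕ)).hasSum_iff]
    have hsum := summable_mul_of_summable_norm (hf 0).norm ih'.summable.norm
    have key := (hf 0).hasSum.mul ih' hsum
    have hcomp : (fun z : Fin (r + 1) → ℕ => ∏ j, f j (z j)) ∘ Fin.consEquiv (fun _ => ℕ) =
        fun x : ℕ × (Fin r → ℕ) => f 0 x.1 * ∏ j, f j.succ (x.2 j) := by
      ext x
      simp [Fin.prod_univ_succ, Fin.consEquiv]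
    rw [hcomp, Fin.prod_univ_succ]
    exact key

theorem hasSum_det {r : ℕ} (F : Fin r → Fin r → ℕ → ℝ) (v : Fin r → Fin r → ℝ)
    (h : ∀ i j, HasSum (F i j) (v i j)) :
    HasSum (fun z : Fin r → ℕ => Matrix.det (Matrix.of fun i j => F i j (z j)))
      (Matrix.det (Matrix.of v)) := by
  simp only [Matrix.det_apply, Matrix.of_apply]
  refine hasSum_sum fun σ _ => ?_
  have := hasSum_pi_prod (fun j => F (σ j) j) (fun j => (h _ _).summable)
  rw [Finset.prod_congr rfl fun j _ => (h (σ j) j).tsum_eq] at this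
  exact this.const_smul _

/-- A sum of determinants over the antitone multi-indices of a box is a determinant of sums. -/
theorem hasSum_antitone_det {r : ℕ} (I : Fin r → ℕ → Prop) (P : (Fin r → ℕ) → Prop)
    (hP : ∀ z, P z ↔ ∀ j, I j (z j)) (hanti : ∀ z, P z → Antitone z)
    (F : Fin r → Fin r → ℕ → ℝ) (v : Fin r → Fin r → ℝ)
    (h : ∀ i j, HasSum (fun l => if I j l then F i j l else 0) (v i j)) :
    HasSum (fun z : {z : Fin r → ℕ // Antitone z} =>
      (if P z.1 then 1 else 0) * Matrix.det (Matrix.of fun i j => F i j (z.1 j)))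
      (Matrix.det (Matrix.of v)) := by
  have hdet : ∀ z : Fin r → ℕ,
      Matrix.det (Matrix.of fun i j => if I j (z j) then F i j (z j) else 0) =
        (if P z then 1 else 0) * Matrix.det (Matrix.of fun i j => F i j (z j)) := by
    intro z
    have h1 := Matrix.det_mul_row (fun j => if I j (z j) then (1 : ℝ) else 0)
      (Matrix.of fun i j => F i j (z j))
    have h2 : (∏ j, if I j (z j) then (1 : ℝ) else 0) = if P z then 1 else 0 := by
      by_cases hz : ∀ j, I j (z j)
      · simp [(hP z).2 hz, hz]
      · rw [if_neg (mt (hP z).1 hz)]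
        obtain ⟨j, hj⟩ := not_forall.1 hz
        exact Finset.prod_eq_zero (Finset.mem_univ j) (if_neg hj)
    rw [h2] at h1
    rw [← h1]
    congr 1
    ext i j
    simp
  have key : HasSum (fun z : Fin r → ℕ => (if P z then 1 else 0) *
      Matrix.det (Matrix.of fun i j => F i j (z j))) (Matrix.det (Matrix.of v)) := by
    simpa only [hdet] using hasSum_det (fun i j l => if I j l then F i j l else 0) v h
  have hsupp : Function.support (fun z : Fin r → ℕ => (if P z then (1 : ℝ) else 0) *
      Matrix.det (Matrix.of fun i j => F i j (z j))) ⊆ {z | Antitone z} := by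
    intro z hz
    by_contra hc
    exact hz (by simp only [if_neg (fun h' => hc (hanti z h')), zero_mul])
  exact (hasSum_subtype_iff_of_support_subset hsupp).2 key

theorem hasSum_ite_Icc_telescope (F Φ : ℕ → ℝ) (hF : ∀ x, F x = Φ (x + 1) - Φ x)
    (s lo hi : ℕ) (hle : lo ≤ hi + 1) :
    HasSum (fun l => if lo ≤ l ∧ l ≤ hi then F (l + s) else 0)
      (Φ (hi + s + 1) - Φ (lo + s)) := by
  have hsum : ∑ l ∈ Finset.Icc lo hi, (if lo ≤ l ∧ l ≤ hi then F (l + s) else 0) =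
      Φ (hi + s + 1) - Φ (lo + s) := by
    rw [Finset.sum_congr rfl (g := fun l => Φ (l + 1 + s) - Φ (l + s))]
    · have := Finset.sum_Ico_sub (fun l => Φ (l + s)) hle
      rw [Finset.Ico_add_one_right_eq_Icc] at this
      rw [this, add_right_comm]
    · intro l hl
      rw [Finset.mem_Icc] at hl
      rw [if_pos hl, hF, add_right_comm]
  rw [← hsum]
  refine hasSum_sum_of_ne_finset_zero fun l hl => ?_
  rw [Finset.mem_Icc] at hl
  exact if_neg hl

theorem hasSum_ite_Ici (F : ℕ → ℝ) (s lo : ℕ) (a : ℝ)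
    (h : HasSum (fun l => F (lo + s + l)) a) :
    HasSum (fun l => if lo ≤ l then F (l + s) else 0) a := by
  have hinj : Function.Injective (fun l : ℕ => lo + l) := add_right_injective lo
  refine (hinj.hasSum_iff ?_).1 ?_
  · intro x hx
    refine if_neg fun hle => hx ⟨x - lo, ?_⟩
    simp only
    omega
  · convert h using 2 with l
    simp [add_right_comm]

/-! ### Determinants of differences -/

theorem det_col_sub {r : ℕ} (M v : Matrix (Fin r) (Fin r) ℝ)
    (h0 : ∀ i j : Fin r, (j : ℕ) = 0 → v i j = M i j)
    (hs : ∀ i j j' : Fin r, (j' : ℕ) + 1 = j → v i j = M i j - M i j') :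
    v.det = M.det := by
  cases r with
  | zero => simp
  | succ r =>
    refine (Matrix.det_eq_of_forall_col_eq_smul_add_pred (fun _ => 1) ?_ ?_).symm
    · exact fun i => (h0 i 0 rfl).symm
    · intro i j
      rw [hs i j.succ j.castSucc (by simp)]
      ring

theorem det_row_sub {r : ℕ} (M v : Matrix (Fin r) (Fin r) ℝ)
    (h0 : ∀ i j : Fin r, (i : ℕ) + 1 = r → v i j = M i j)
    (hs : ∀ i i' j : Fin r, (i : ℕ) + 1 = i' → v i j = M i j - M i' j) :
    v.det = M.det := by
  rw [← Matrix.det_transpose v, ← Matrix.det_transpose M,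
    ← Matrix.det_submatrix_equiv_self Fin.revPerm v.transpose,
    ← Matrix.det_submatrix_equiv_self Fin.revPerm M.transpose]
  apply det_col_sub
  · intro i j hj
    simp only [Matrix.submatrix_apply, Matrix.transpose_apply, Fin.revPerm_apply]
    exact h0 _ _ (by rw [Fin.val_rev]; omega)
  · intro i j j' hj
    simp only [Matrix.submatrix_apply, Matrix.transpose_apply, Fin.revPerm_apply]
    exact hs _ _ _ (by rw [Fin.val_rev, Fin.val_rev]; omega)

theorem det_of_last_col {r : ℕ} (v : Matrix (Fin (r + 1)) (Fin (r + 1)) ℝ)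
    (h0 : ∀ i : Fin r, v i.castSucc (Fin.last r) = 0) (h1 : v (Fin.last r) (Fin.last r) = 1) :
    v.det = (Matrix.of fun i j : Fin r => v i.castSucc j.castSucc).det := by
  rw [Matrix.det_succ_column v (Fin.last r), Fin.sum_univ_castSucc]
  simp only [h0, h1, mul_zero, zero_mul, Finset.sum_const_zero, zero_add]
  rw [(Even.add_self _).neg_one_pow]
  simp only [one_mul]
  congr 1
  ext i j
  simp [Fin.succAbove_last]

/-! ### Determinantal intertwining over interlacing patterns -/

/-- Summing over the patterns `z ≺ m` with at most as many rows as `m`. -/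
theorem hasSum_interlace_below {r R : ℕ} (hrR : r ≤ R) (m : Fin R → ℕ) (hm : Antitone m)
    (s : Fin r → ℕ) (F Φ : Fin r → ℕ → ℝ) (hF : ∀ j x, F j x = Φ j (x + 1) - Φ j x) :
    HasSum (fun z : {z : Fin r → ℕ // Antitone z} =>
      (if interlaceN z.1 m then 1 else 0) *
        Matrix.det (Matrix.of fun i j => F j (z.1 i + s i)))
      (Matrix.det (Matrix.of fun i j : Fin r =>
        Φ j (m (Fin.castLE hrR i) + s i + 1) -
          Φ j ((if h : (i : ℕ) + 1 < R then m ⟨(i : ℕ) + 1, h⟩ else 0) + s i))) := by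
  have key := hasSum_antitone_det
    (fun i x => (if h : (i : ℕ) + 1 < R then m ⟨(i : ℕ) + 1, h⟩ else 0) ≤ x ∧
      x ≤ m (Fin.castLE hrR i)) (fun z => interlaceN z m) ?_ ?_
    (fun j i x => F j (x + s i))
    (fun j i => Φ j (m (Fin.castLE hrR i) + s i + 1) -
          Φ j ((if h : (i : ℕ) + 1 < R then m ⟨(i : ℕ) + 1, h⟩ else 0) + s i)) ?_
  · convert key using 1
    · ext z
      rw [← Matrix.det_transpose]
      rfl
    · rw [← Matrix.det_transpose]
      rfl
  · intro z
    constructor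
    · rintro ⟨h1, h2⟩ i
      refine ⟨?_, h1 i (i.2.trans_le hrR)⟩
      split_ifs with h
      · exact h2 i h
      · exact Nat.zero_le _
    · intro h
      refine ⟨fun i _ => (h i).2, fun i hi => ?_⟩
      simpa [hi] using (h i).1
  · rintro z ⟨h1, h2⟩
    cases r with
    | zero => exact fun i => i.elim0
    | succ r =>
      refine Fin.antitone_iff_succ_le.2 fun i => ?_
      have hi : (i : ℕ) + 1 < R := by omega
      exact (h1 i.succ hi).trans (h2 i.castSucc hi)
  · intro j i
    convert hasSum_ite_Icc_telescope (F j) (Φ j) (hF j) _ _ _ ?_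
    split_ifs with h
    · exact (hm (by simp [Fin.le_def])).trans (Nat.le_succ _)
    · exact Nat.zero_le _

/-- Summing over the patterns `z ≻ l` with at most one row more than `l`. -/
theorem hasSum_interlace_above {r R : ℕ} (hRr : R ≤ r + 1) (l : Fin r → ℕ) (hl : Antitone l)
    (s : Fin R → ℕ) (F Φ : Fin R → ℕ → ℝ) (hF : ∀ i x, F i x = Φ i x - Φ i (x + 1))
    (hsum : ∀ i k, HasSum (fun x => F i (k + x)) (Φ i k)) :
    HasSum (fun z : {z : Fin R → ℕ // Antitone z} =>
      (if interlaceN l z.1 then 1 else 0) *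
        Matrix.det (Matrix.of fun i j => F i (z.1 j + s j)))
      (Matrix.det (Matrix.of fun i j : Fin R =>
        Φ i ((if h : (j : ℕ) < r then l ⟨j, h⟩ else 0) + s j) -
          (if h : 0 < (j : ℕ) then Φ i (l ⟨(j : ℕ) - 1, by omega⟩ + s j + 1) else 0))) := by
  refine hasSum_antitone_det
    (fun j x => (if h : (j : ℕ) < r then l ⟨j, h⟩ else 0) ≤ x ∧
      ∀ h : 0 < (j : ℕ), x ≤ l ⟨(j : ℕ) - 1, by omega⟩) (fun z => interlaceN l z) ?_ ?_
    (fun i j x => F i (x + s j)) _ ?_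
  · intro z
    constructor
    · rintro ⟨h1, h2⟩ j
      constructor
      · split_ifs with h
        · exact h1 ⟨j, h⟩ j.2
        · exact Nat.zero_le _
      · intro h
        have hj : (j : ℕ) - 1 + 1 < R := by omega
        have := h2 ⟨(j : ℕ) - 1, by omega⟩ hj
        have hjj : (⟨(j : ℕ) - 1 + 1, hj⟩ : Fin R) = j := Fin.ext (by simp only; omega)
        simpa only [hjj] using this
    · intro h
      refine ⟨fun i hi => ?_, fun i hi => (h ⟨(i : ℕ) + 1, hi⟩).2 (Nat.succ_pos _)⟩
      simpa using (h ⟨i, hi⟩).1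
  · rintro z ⟨h1, h2⟩
    cases R with
    | zero => exact fun i => i.elim0
    | succ R =>
      refine Fin.antitone_iff_succ_le.2 fun i => ?_
      have hi : (i : ℕ) < r := by omega
      exact (h2 ⟨i, hi⟩ (by simp)).trans (h1 ⟨i, hi⟩ (by simp))
  · intro i j
    by_cases h : 0 < (j : ℕ)
    · simp only [h, forall_true_left, dif_pos]
      have := hasSum_ite_Icc_telescope (F i) (fun x => - Φ i x)
        (fun x => by rw [hF]; ring) (s j) (if h : (j : ℕ) < r then l ⟨j, h⟩ else 0)
        (l ⟨(j : ℕ) - 1, by omega⟩) ?_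
      · convert this using 1
        ring
      · split_ifs with h'
        · exact (hl (by simp [Fin.le_def])).trans (Nat.le_succ _)
        · exact Nat.zero_le _
    · simp only [h, forall_false, and_true, sub_zero, dif_neg, not_false_eq_true]
      exact hasSum_ite_Ici (F i) _ _ _ (hsum i _)

theorem intertwine_det_same_length {r R : ℕ} (hR : R = r) (A B G : ℕ → ℕ → ℝ)
    (hB : ∀ x k, B x k = G (x + 1) k - G x k) (hG : ∀ k, G 0 k = 0)
    (hA : ∀ m x, A m x = G (m + 1) x - G (m + 1) (x + 1))
    (hsum : ∀ m k, HasSum (fun x => A m (k + x)) (G (m + 1) k))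
    (m : Fin R → ℕ) (hm : Antitone m) (l : Fin r → ℕ) (hl : Antitone l) :
    ∃ S : ℝ,
      HasSum (fun z : {z : Fin r → ℕ // Antitone z} => (if interlaceN z.1 m then 1 else 0) *
        Matrix.det (Matrix.of fun i j : Fin r =>
          B (z.1 i + (r - 1 - (i : ℕ))) (l j + (r - 1 - (j : ℕ))))) S ∧
      HasSum (fun z : {z : Fin R → ℕ // Antitone z} => (if interlaceN l z.1 then 1 else 0) *
        Matrix.det (Matrix.of fun i j : Fin R =>
          A (m i + (R - 1 - (i : ℕ))) (z.1 j + (R - 1 - (j : ℕ))))) S := by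
  subst hR
  refine ⟨Matrix.det (Matrix.of fun i j : Fin R =>
    G (m i + (R - 1 - (i : ℕ)) + 1) (l j + (R - 1 - (j : ℕ)))), ?_, ?_⟩
  · have key := hasSum_interlace_below le_rfl m hm (fun i => R - 1 - (i : ℕ))
      (fun j x => B x (l j + (R - 1 - (j : ℕ)))) (fun j x => G x (l j + (R - 1 - (j : ℕ))))
      (fun j x => hB _ _)
    convert key using 1
    symm
    apply det_row_sub
    · intro i j hi
      have h1 : R - 1 - (i : ℕ) = 0 := by omega
      simp [hi, h1, hG]
    · intro i i' j hi
      have h1 : (i : ℕ) + 1 < R := by omega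
      have h2 : R - 1 - (i : ℕ) = R - 1 - (i' : ℕ) + 1 := by omega
      have h3 : (⟨(i : ℕ) + 1, h1⟩ : Fin R) = i' := Fin.ext hi
      simp [h1, h2, h3, add_assoc]
  · have key := hasSum_interlace_above (Nat.le_succ R) l hl (fun i => R - 1 - (i : ℕ))
      (fun i x => A (m i + (R - 1 - (i : ℕ))) x) (fun i x => G (m i + (R - 1 - (i : ℕ)) + 1) x)
      (fun i x => hA _ _) (fun i k => hsum _ k)
    convert key using 1
    symm
    apply det_col_sub
    · intro i j hj
      simp [hj]
    · intro i j j' hj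
      have h1 : 0 < (j : ℕ) := by omega
      have h2 : R - 1 - (j' : ℕ) = R - 1 - (j : ℕ) + 1 := by omega
      have h3 : (⟨(j : ℕ) - 1, by omega⟩ : Fin R) = j' := Fin.ext (by simp only; omega)
      simp [h1, h2, h3, add_assoc]

theorem intertwine_det_succ_length {r R : ℕ} (hR : R = r + 1) (A B G : ℕ → ℕ → ℝ)
    (hA : ∀ x k, A x k = G (x + 1) (k + 1) - G x (k + 1)) (hG : ∀ m, G m 0 = 1)
    (hB : ∀ m x, B m x = G m x - G m (x + 1))
    (hsum : ∀ m k, HasSum (fun x => B m (k + x)) (G m k))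
    (m : Fin R → ℕ) (hm : Antitone m) (l : Fin r → ℕ) (hl : Antitone l) :
    ∃ S : ℝ,
      HasSum (fun z : {z : Fin r → ℕ // Antitone z} => (if interlaceN z.1 m then 1 else 0) *
        Matrix.det (Matrix.of fun i j : Fin r =>
          A (z.1 i + (r - 1 - (i : ℕ))) (l j + (r - 1 - (j : ℕ))))) S ∧
      HasSum (fun z : {z : Fin R → ℕ // Antitone z} => (if interlaceN l z.1 then 1 else 0) *
        Matrix.det (Matrix.of fun i j : Fin R =>
          B (m i + (R - 1 - (i : ℕ))) (z.1 j + (R - 1 - (j : ℕ))))) S := by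
  subst hR
  let b : Fin (r + 1) → ℕ := fun i => m i + (r + 1 - 1 - (i : ℕ))
  let a : Fin (r + 1) → ℕ := fun j =>
    (if h : (j : ℕ) < r then l ⟨j, h⟩ else 0) + (r + 1 - 1 - (j : ℕ))
  have ha : ∀ j : Fin r, a j.castSucc = l j + (r - 1 - (j : ℕ)) + 1 := by
    intro j
    have : r - (j : ℕ) = r - 1 - (j : ℕ) + 1 := by omega
    simp [a, this, add_assoc]
  have ha' : a (Fin.last r) = 0 := by simp [a]
  refine ⟨Matrix.det (Matrix.of fun i j => G (b i) (a j)), ?_, ?_⟩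
  · have key := hasSum_interlace_below (Nat.le_succ r) m hm (fun i => r - 1 - (i : ℕ))
      (fun j x => A x (l j + (r - 1 - (j : ℕ)))) (fun j x => G x (l j + (r - 1 - (j : ℕ)) + 1))
      (fun j x => hA _ _)
    convert key using 1
    rw [← det_row_sub (Matrix.of fun i j => G (b i) (a j))
      (Matrix.of fun i j => G (b i) (a j) -
        if h : (i : ℕ) + 1 < r + 1 then G (b ⟨(i : ℕ) + 1, h⟩) (a j) else 0),
      det_of_last_col]
    · congr 1
      ext i j
      have h2 : r - (i : ℕ) = r - 1 - (i : ℕ) + 1 := by omega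
      have h3 : r - ((i : ℕ) + 1) = r - 1 - (i : ℕ) := by omega
      simp [ha, b, h2, h3, add_assoc]
      rfl
    · intro i
      simp [ha', hG]
    · simp [ha', hG]
    · intro i j hi
      have h1 : ¬ (i : ℕ) + 1 < r + 1 := by omega
      rw [Matrix.of_apply, dif_neg h1, sub_zero]
      rfl
    · intro i i' j hi
      have h1 : (i : ℕ) + 1 < r + 1 := by omega
      have h3 : (⟨(i : ℕ) + 1, h1⟩ : Fin (r + 1)) = i' := Fin.ext hi
      rw [Matrix.of_apply, dif_pos h1, h3]
      rfl
  · have key := hasSum_interlace_above le_rfl l hl (fun i : Fin (r + 1) => r + 1 - 1 - (i : ℕ))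
      (fun i x => B (b i) x) (fun i x => G (b i) x)
      (fun i x => hB _ _) (fun i k => hsum _ k)
    convert key using 1
    symm
    apply det_col_sub
    · intro i j hj
      have h1 : ¬ 0 < (j : ℕ) := by omega
      rw [Matrix.of_apply, dif_neg h1, sub_zero]
      rfl
    · intro i j j' hj
      have h1 : 0 < (j : ℕ) := by omega
      have h2 : r - (j' : ℕ) = r - (j : ℕ) + 1 := by omega
      have h3 : (j' : ℕ) < r := by omega
      have h4 : (⟨(j : ℕ) - 1, by omega⟩ : Fin r) = ⟨j', h3⟩ := Fin.ext (by simp only; omega)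
      rw [Matrix.of_apply, dif_pos h1, h4]
      simp [h2, h3, a, add_assoc]

/-! ### Tail sums of an even summable sequence -/

/-- The tail `∑_{j ≥ k} c j`. -/
noncomputable def tailSum (c : ℤ → ℝ) (k : ℤ) : ℝ := ∑' j : ℕ, c (k + j)

theorem hasSum_tailSum {c : ℤ → ℝ} (hc : Summable c) (k : ℤ) :
    HasSum (fun j : ℕ => c (k + j)) (tailSum c k) :=
  (hc.comp_injective ((add_right_injective k).comp Nat.cast_injective)).hasSum

theorem tailSum_sub {c : ℤ → ℝ} (hc : Summable c) (k : ℤ) :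
    tailSum c k - tailSum c (k + 1) = c k := by
  have h1 := (hasSum_tailSum hc k).summable.tsum_eq_zero_add
  have h2 : ∀ j : ℕ, c (k + ((j + 1 : ℕ) : ℤ)) = c (k + 1 + j) := by
    intro j
    congr 1
    push_cast
    ring
  simp only [h2, Nat.cast_zero, add_zero] at h1
  unfold tailSum
  linarith

theorem tailSum_add_tailSum {c : ℤ → ℝ} {a : ℝ} (hc : HasSum c a) (heven : ∀ j, c (-j) = c j)
    (k : ℤ) : tailSum c k + tailSum c (1 - k) = a := by
  have h1 : HasSum (fun j => c (k + j)) a := (Equiv.addLeft k).hasSum_iff.2 hc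
  refine HasSum.unique (HasSum.of_nat_of_neg_add_one (hasSum_tailSum hc.summable k) ?_) h1
  convert hasSum_tailSum hc.summable (1 - k) using 2 with j
  rw [← heven]
  congr 1
  ring

/-! ### Fourier cosine coefficients -/

/-- The Fourier cosine coefficients of `θ ↦ ψ (cos θ)`. -/
noncomputable def cosCoeff (ψ : ℝ → ℝ) (j : ℤ) : ℝ :=
  1 / π * ∫ θ in (0 : ℝ)..π, cos (j * θ) * ψ (cos θ)

theorem cosCoeff_neg (ψ : ℝ → ℝ) (j : ℤ) : cosCoeff ψ (-j) = cosCoeff ψ j := by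
  simp [cosCoeff]

theorem chebJ_half_mul_sin (n : ℕ) (θ : ℝ) :
    chebJ (1 / 2) n (cos θ) * sin θ = sin ((n + 1) * θ) := by
  induction n using Nat.twoStepInduction with
  | zero => simp [chebJ]
  | one =>
    simp only [chebJ, if_true, Nat.cast_one]
    rw [one_add_one_eq_two, sin_two_mul]
    ring
  | more n h1 h2 =>
    simp only [chebJ]
    rw [sub_mul, mul_assoc, h1, h2]
    have e1 : ((n + 2 : ℕ) + 1 : ℝ) * θ = ((n + 1 : ℕ) + 1) * θ + θ := by push_cast; ring
    have e2 : ((n : ℝ) + 1) * θ = ((n + 1 : ℕ) + 1) * θ - θ := by push_cast; ring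
    rw [e1, e2, sin_add, sin_sub]
    ring

theorem chebJ_neg_half_mul_cos (n : ℕ) (θ : ℝ) :
    chebJ (-(1 / 2)) n (cos θ) * cos (θ / 2) = cos ((n + 1 / 2) * θ) := by
  induction n using Nat.twoStepInduction with
  | zero => simp [chebJ, div_eq_inv_mul]
  | one =>
    have h : ¬ (-(1 / 2) : ℝ) = 1 / 2 := by norm_num
    simp only [chebJ, if_neg h]
    have e1 : ((1 : ℕ) + 1 / 2 : ℝ) * θ = 3 * (θ / 2) := by push_cast; ring
    have e2 : cos θ = 2 * cos (θ / 2) ^ 2 - 1 := by rw [← cos_two_mul]; ring_nf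
    rw [e1, e2, cos_three_mul]
    ring
  | more n h1 h2 =>
    simp only [chebJ]
    rw [sub_mul, mul_assoc, h1, h2]
    have e1 : ((n + 2 : ℕ) + 1 / 2 : ℝ) * θ = ((n + 1 : ℕ) + 1 / 2) * θ + θ := by push_cast; ring
    have e2 : ((n : ℝ) + 1 / 2) * θ = ((n + 1 : ℕ) + 1 / 2) * θ - θ := by push_cast; ring
    rw [e1, e2, cos_add, cos_sub]
    ring

theorem integral_mul_sqrt_inv_eq_integral_cos (h : ℝ → ℝ) :
    ∫ x in (-1 : ℝ)..1, h x * √(1 - x ^ 2)⁻¹ = ∫ θ in (0 : ℝ)..π, h (cos θ) := by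
  rw [← Polynomial.Chebyshev.integral_measureT,
    Polynomial.Chebyshev.integral_measureT_eq_integral_cos]

theorem innerJ_half (f g : ℝ → ℝ) :
    innerJ (1 / 2) f g = 2 / π * ∫ θ in (0 : ℝ)..π, f (cos θ) * g (cos θ) * sin θ ^ 2 := by
  have h : ∀ θ, sin θ ^ 2 = 1 - cos θ ^ 2 := sin_sq
  simp only [h]
  rw [← integral_mul_sqrt_inv_eq_integral_cos (fun x => f x * g x * (1 - x ^ 2)), innerJ]
  congr 1
  · norm_num
  · refine intervalIntegral.integral_congr fun x hx => ?_
    rw [Set.uIcc_of_le (by norm_num)] at hx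
    have ha : 0 ≤ 1 - x := by linarith [hx.2]
    have hb : 0 ≤ 1 + x := by linarith [hx.1]
    have hab : 1 - x ^ 2 = (1 - x) * (1 + x) := by ring
    rw [← sqrt_eq_rpow, ← sqrt_eq_rpow, hab, sqrt_inv, sqrt_mul ha]
    rcases eq_or_ne (√(1 - x)) 0 with h1 | h1
    · simp [h1]
    rcases eq_or_ne (√(1 + x)) 0 with h2 | h2
    · simp [h2]
    field_simp
    rw [sq_sqrt ha, sq_sqrt hb]

theorem innerJ_neg_half (f g : ℝ → ℝ) :
    innerJ (-(1 / 2)) f g =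
      2 / π * ∫ θ in (0 : ℝ)..π, f (cos θ) * g (cos θ) * cos (θ / 2) ^ 2 := by
  have h : ∀ θ, cos (θ / 2) ^ 2 = (1 + cos θ) / 2 := by
    intro θ
    rw [cos_sq]
    ring_nf
  simp only [h]
  rw [← integral_mul_sqrt_inv_eq_integral_cos (fun x => f x * g x * ((1 + x) / 2)), innerJ,
    ← intervalIntegral.integral_const_mul, ← intervalIntegral.integral_const_mul]
  refine intervalIntegral.integral_congr fun x hx => ?_
  rw [Set.uIcc_of_le (by norm_num)] at hx
  have ha : 0 ≤ 1 - x := by linarith [hx.2]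
  have hb : 0 ≤ 1 + x := by linarith [hx.1]
  have hab : 1 - x ^ 2 = (1 - x) * (1 + x) := by ring
  rw [rpow_neg ha, ← sqrt_eq_rpow, ← sqrt_eq_rpow, hab, sqrt_inv, sqrt_mul ha]
  rcases eq_or_ne (√(1 - x)) 0 with h1 | h1
  · simp [h1]
  rcases eq_or_ne (√(1 + x)) 0 with h2 | h2
  · simp [h2]
  norm_num
  field_simp
  rw [sq_sqrt hb]

theorem innerJ_half_chebJ (ψ : ℝ → ℝ) (hψ : Continuous fun θ => ψ (cos θ)) (m k : ℕ) :
    innerJ (1 / 2) (chebJ (1 / 2) m) (fun x => chebJ (1 / 2) k x * ψ x) =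
      cosCoeff ψ (m - k) - cosCoeff ψ (m + k + 2) := by
  have hi : ∀ j : ℤ, IntervalIntegrable (fun θ => cos (j * θ) * ψ (cos θ)) volume 0 π :=
    fun j => (Continuous.mul (by fun_prop) hψ).intervalIntegrable _ _
  rw [innerJ_half, cosCoeff, cosCoeff, ← mul_sub, ← intervalIntegral.integral_sub
    (hi _)
    (hi _),
    ← intervalIntegral.integral_const_mul, ← intervalIntegral.integral_const_mul]
  refine intervalIntegral.integral_congr fun θ _ => ?_
  have h1 := chebJ_half_mul_sin m θ
  have h2 := chebJ_half_mul_sin k θ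
  have e1 : (((m : ℤ) - k : ℤ) : ℝ) * θ = (m + 1) * θ - (k + 1) * θ := by push_cast; ring
  have e2 : (((m : ℤ) + k + 2 : ℤ) : ℝ) * θ = (m + 1) * θ + (k + 1) * θ := by push_cast; ring
  rw [e1, e2, cos_sub, cos_add, ← h1, ← h2]
  ring

theorem innerJ_neg_half_chebJ (ψ : ℝ → ℝ) (hψ : Continuous fun θ => ψ (cos θ)) (m k : ℕ) :
    innerJ (-(1 / 2)) (chebJ (-(1 / 2)) m) (fun x => chebJ (-(1 / 2)) k x * ψ x) =
      cosCoeff ψ (m - k) + cosCoeff ψ (m + k + 1) := by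
  have hi : ∀ j : ℤ, IntervalIntegrable (fun θ => cos (j * θ) * ψ (cos θ)) volume 0 π :=
    fun j => (Continuous.mul (by fun_prop) hψ).intervalIntegrable _ _
  rw [innerJ_neg_half, cosCoeff, cosCoeff, ← mul_add, ← intervalIntegral.integral_add
    (hi _)
    (hi _),
    ← intervalIntegral.integral_const_mul, ← intervalIntegral.integral_const_mul]
  refine intervalIntegral.integral_congr fun θ _ => ?_
  have h1 := chebJ_neg_half_mul_cos m θ
  have h2 := chebJ_neg_half_mul_cos k θ
  have e1 : (((m : ℤ) - k : ℤ) : ℝ) * θ = (m + 1 / 2) * θ - (k + 1 / 2) * θ := by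
    push_cast; ring
  have e2 : (((m : ℤ) + k + 1 : ℤ) : ℝ) * θ = (m + 1 / 2) * θ + (k + 1 / 2) * θ := by
    push_cast; ring
  rw [e1, e2, cos_sub, cos_add, ← h1, ← h2]
  ring

theorem sq_mul_integral_cos_mul {g g' g'' : ℝ → ℝ} (hg : ∀ x, HasDerivAt g (g' x) x)
    (hg' : ∀ x, HasDerivAt g' (g'' x) x) (hg'' : Continuous g'') (h0 : g' 0 = 0) (hπ : g' π = 0)
    (j : ℤ) : (j : ℝ) ^ 2 * ∫ θ in (0 : ℝ)..π, cos (j * θ) * g θ =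
      -∫ θ in (0 : ℝ)..π, cos (j * θ) * g'' θ := by
  have hgc : Continuous g := continuous_iff_continuousAt.2 fun x => (hg x).continuousAt
  have hd : ∀ θ ∈ Set.uIcc 0 π, HasDerivAt
      (fun θ => (j : ℝ) * (sin (j * θ) * g θ) + cos (j * θ) * g' θ)
      ((j : ℝ) ^ 2 * (cos (j * θ) * g θ) + cos (j * θ) * g'' θ) θ := by
    intro θ _
    have hl : HasDerivAt (fun θ : ℝ => (j : ℝ) * θ) j θ := by
      simpa using (hasDerivAt_id θ).const_mul (j : ℝ)
    refine (((hl.sin.mul (hg θ)).const_mul (j : ℝ)).add (hl.cos.mul (hg' θ))).congr_deriv ?_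
    ring
  have hi1 : IntervalIntegrable (fun θ => (j : ℝ) ^ 2 * (cos (j * θ) * g θ)) volume 0 π :=
    Continuous.intervalIntegrable (by fun_prop) _ _
  have hi2 : IntervalIntegrable (fun θ => cos (j * θ) * g'' θ) volume 0 π :=
    Continuous.intervalIntegrable (by fun_prop) _ _
  have key := intervalIntegral.integral_eq_sub_of_hasDerivAt hd (hi1.add hi2)
  rw [intervalIntegral.integral_add hi1 hi2, intervalIntegral.integral_const_mul] at key
  simp only [sin_int_mul_pi, h0, hπ, mul_zero, zero_mul, sin_zero, add_zero, sub_zero] at key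
  linarith

theorem summable_cosCoeff {ψ g' g'' : ℝ → ℝ} (hg : ∀ x, HasDerivAt (fun θ => ψ (cos θ)) (g' x) x)
    (hg' : ∀ x, HasDerivAt g' (g'' x) x) (hg'' : Continuous g'') (h0 : g' 0 = 0)
    (hπ : g' π = 0) : Summable (cosCoeff ψ) := by
  obtain ⟨C, hC⟩ := (isCompact_uIcc (a := (0 : ℝ)) (b := π)).exists_bound_of_continuousOn
    hg''.continuousOn
  refine Summable.of_norm_bounded_eventually
    (g := fun j : ℤ => C * (1 / (j : ℝ) ^ 2))
    ((Real.summable_one_div_int_pow.2 one_lt_two).mul_left C) ?_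
  filter_upwards [(Set.finite_singleton (0 : ℤ)).compl_mem_cofinite] with j hj
  have hj0 : (j : ℝ) ≠ 0 := Int.cast_ne_zero.2 hj
  have key := sq_mul_integral_cos_mul hg hg' hg'' h0 hπ j
  have hb : ‖∫ θ in (0 : ℝ)..π, cos (j * θ) * g'' θ‖ ≤ C * |π - 0| := by
    refine intervalIntegral.norm_integral_le_of_norm_le_const fun x hx => ?_
    rw [norm_mul]
    calc _ ≤ 1 * C := mul_le_mul (abs_cos_le_one _) (hC x (Set.uIoc_subset_uIcc hx))
          (norm_nonneg _) zero_le_one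
      _ = C := one_mul C
  have he : cosCoeff ψ j = -(∫ θ in (0 : ℝ)..π, cos (j * θ) * g'' θ) / (π * (j : ℝ) ^ 2) := by
    rw [cosCoeff, ← key]
    field_simp
  rw [he, norm_div, norm_neg, norm_of_nonneg (by positivity : 0 ≤ π * (j : ℝ) ^ 2),
    div_le_iff₀ (by positivity)]
  rw [sub_zero, abs_of_pos pi_pos] at hb
  refine hb.trans (le_of_eq ?_)
  field_simp

theorem integral_exp_mul_eq_cosCoeff (ψ : ℝ → ℝ) (hψ : Continuous fun θ => ψ (cos θ)) (n : ℤ) :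
    ∫ x in (-π)..π, Complex.exp (-(n * x * Complex.I)) * (ψ (cos x) : ℂ) =
      2 * π * cosCoeff ψ n := by
  have hψ' : Continuous fun θ : ℝ => (ψ (cos θ) : ℂ) := Complex.continuous_ofReal.comp hψ
  have hi : ∀ a b : ℝ, IntervalIntegrable
      (fun x : ℝ => Complex.exp (-(n * x * Complex.I)) * (ψ (cos x) : ℂ)) volume a b :=
    fun a b => Continuous.intervalIntegrable (by fun_prop) _ _
  have hi' : IntervalIntegrable
      (fun x : ℝ => Complex.exp (-(n * (-x : ℝ) * Complex.I)) * (ψ (cos (-x)) : ℂ))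
      volume 0 π := by
    refine Continuous.intervalIntegrable ?_ _ _
    simp only [cos_neg]
    fun_prop
  rw [← intervalIntegral.integral_add_adjacent_intervals (hi (-π) 0) (hi 0 π)]
  have hneg := intervalIntegral.integral_comp_neg (a := 0) (b := π)
    (fun x : ℝ => Complex.exp (-(n * x * Complex.I)) * (ψ (cos x) : ℂ))
  rw [neg_zero] at hneg
  rw [← hneg, ← intervalIntegral.integral_add hi' (hi 0 π), cosCoeff]
  push_cast
  rw [← intervalIntegral.integral_ofReal, ← mul_assoc,
    show (2 * π * (1 / π) : ℂ) = 2 by field_simp, ← intervalIntegral.integral_const_mul]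
  refine intervalIntegral.integral_congr fun x _ => ?_
  simp only [cos_neg, Complex.ofReal_mul, Complex.ofReal_cos, Complex.ofReal_intCast]
  rw [← mul_assoc, Complex.two_cos]
  ring_nf

theorem hasSum_cosCoeff (ψ : ℝ → ℝ) (hψ : Continuous fun θ => ψ (cos θ))
    (hsum : Summable (cosCoeff ψ)) : HasSum (cosCoeff ψ) (ψ 1) := by
  have : Fact (0 < 2 * π) := ⟨two_pi_pos⟩
  have hper : Function.Periodic (fun θ => (ψ (cos θ) : ℂ)) (2 * π) := fun θ => by simp
  have hψ' : Continuous fun θ : ℝ => (ψ (cos θ) : ℂ) := Complex.continuous_ofReal.comp hψ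
  let f : C(AddCircle (2 * π), ℂ) := ⟨hper.lift, continuous_coinduced_dom.2 hψ'⟩
  have hf : ∀ x : ℝ, f (x : AddCircle (2 * π)) = ψ (cos x) := fun x => rfl
  have hcoeff : ∀ n, fourierCoeff f n = cosCoeff ψ n := by
    intro n
    rw [fourierCoeff_eq_intervalIntegral f n (-π), show -π + 2 * π = π by ring]
    have h1 : ∀ x : ℝ, fourier (-n) (x : AddCircle (2 * π)) • f x =
        Complex.exp (-(n * x * Complex.I)) * (ψ (cos x) : ℂ) := by
      intro x
      rw [hf, fourier_coe_apply, smul_eq_mul]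
      congr 2
      push_cast
      field_simp
    simp only [h1]
    rw [integral_exp_mul_eq_cosCoeff ψ hψ n, Complex.real_smul]
    push_cast
    field_simp
  have hs : Summable (fourierCoeff f) := by
    simp only [funext hcoeff]
    exact Complex.summable_ofReal.2 hsum
  have key := has_pointwise_sum_fourier_series_of_summable hs ((0 : ℝ) : AddCircle (2 * π))
  rw [hf] at key
  simp only [hcoeff, cos_zero] at key
  rw [← Complex.hasSum_ofReal]
  simpa using key

theorem hasSum_cosCoeff_of_contDiffOn (ψ : ℝ → ℝ) (U : Set ℝ) (hU : IsOpen U)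
    (hsub : Set.Icc (-1 : ℝ) 1 ⊆ U) (hψ : ContDiffOn ℝ (⊤ : ℕ∞) ψ U) :
    (Continuous fun θ => ψ (cos θ)) ∧ HasSum (cosCoeff ψ) (ψ 1) := by
  have hmem : ∀ θ, cos θ ∈ U := fun θ => hsub ⟨neg_one_le_cos θ, cos_le_one θ⟩
  have hg : ContDiff ℝ (⊤ : ℕ∞) (fun θ => ψ (cos θ)) := hψ.comp_contDiff contDiff_cos hmem
  have hg1 := contDiff_infty_iff_deriv.1 hg
  have hg2 := contDiff_infty_iff_deriv.1 hg1.2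
  have hzero : ∀ θ, sin θ = 0 → deriv (fun θ => ψ (cos θ)) θ = 0 := by
    intro θ hθ
    have hd : DifferentiableAt ℝ ψ (cos θ) :=
      (hψ.differentiableOn (by simp)).differentiableAt (hU.mem_nhds (hmem θ))
    have := (hd.hasDerivAt.comp θ (hasDerivAt_cos θ)).deriv
    rw [hθ, neg_zero, mul_zero] at this
    exact this
  refine ⟨hg.continuous, hasSum_cosCoeff ψ hg.continuous ?_⟩
  exact summable_cosCoeff (fun x => (hg1.1 x).hasDerivAt) (fun x => (hg2.1 x).hasDerivAt)
    hg2.2.continuous (hzero 0 sin_zero) (hzero π sin_pi)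

/-! ### Dimensions and the intertwining relation -/

theorem dimSp_ne_zero (n : ℕ) (z : Fin (rr n) → ℕ) (hz : Antitone z) : dimSp n z ≠ 0 := by
  have hi : ∀ i : Fin (rr n), ((i : ℕ) : ℝ) + 1 ≤ rr n := fun i => by exact_mod_cast i.2
  have hsq : ∀ x y : ℝ, 0 < y → y < x → x ^ 2 - y ^ 2 ≠ 0 := fun x y hy hxy =>
    (sub_pos.2 (pow_lt_pow_left₀ hxy hy.le two_ne_zero)).ne'
  have hz0 : ∀ i, (0 : ℝ) ≤ z i := fun i => Nat.cast_nonneg _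
  have hlt : ∀ i j : Fin (rr n), j ∈ Finset.Ioi i →
      (z j : ℝ) ≤ z i ∧ ((i : ℕ) : ℝ) + 1 ≤ (j : ℕ) := by
    intro i j hij
    have hij' := Finset.mem_Ioi.1 hij
    exact ⟨Nat.cast_le.2 (hz hij'.le), by exact_mod_cast hij'⟩
  unfold dimSp
  simp only
  split_ifs
  · refine mul_ne_zero (Finset.prod_ne_zero_iff.2 fun i _ => Finset.prod_ne_zero_iff.2
      fun j hj => div_ne_zero (hsq _ _ ?_ ?_) (hsq _ _ ?_ ?_))
      (Finset.prod_ne_zero_iff.2 fun i _ => div_ne_zero (ne_of_gt ?_) (ne_of_gt ?_))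
    all_goals first
      | linarith [hi j, hz0 j, (hlt i j hj).1, (hlt i j hj).2]
      | linarith [hi i, hz0 i]
  · refine Finset.prod_ne_zero_iff.2 fun i _ => Finset.prod_ne_zero_iff.2
      fun j hj => div_ne_zero (hsq _ _ ?_ ?_) (hsq _ _ ?_ ?_)
    all_goals linarith [hi j, hz0 j, (hlt i j hj).1, (hlt i j hj).2]

/-- The determinant in the definition of `Tpsi`. -/
noncomputable def detJ (ψ : ℝ → ℝ) (n : ℕ) (μ lam : Fin (rr n) → ℕ) : ℝ :=
  Matrix.det (Matrix.of fun i j : Fin (rr n) =>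
    innerJ (alph n) (chebJ (alph n) (μ i + (rr n - 1 - (i : ℕ))))
      (fun x => chebJ (alph n) (lam j + (rr n - 1 - (j : ℕ))) x * ψ x))

theorem exists_hasSum_detJ (ψ : ℝ → ℝ) (hψ : Continuous fun θ => ψ (cos θ))
    (hc : HasSum (cosCoeff ψ) 1) (n : ℕ) (m : Fin (rr (n + 1)) → ℕ) (hm : Antitone m)
    (l : Fin (rr n) → ℕ) (hl : Antitone l) :
    ∃ S : ℝ,
      HasSum (fun z : {z : Fin (rr n) → ℕ // Antitone z} =>
        (if interlaceN z.1 m then 1 else 0) * detJ ψ n z.1 l) S ∧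
      HasSum (fun z : {z : Fin (rr (n + 1)) → ℕ // Antitone z} =>
        (if interlaceN l z.1 then 1 else 0) * detJ ψ (n + 1) m z.1) S := by
  set c := cosCoeff ψ
  set T := tailSum c
  have heven : ∀ j, c (-j) = c j := cosCoeff_neg ψ
  have hT : ∀ k, c k = T k - T (k + 1) := fun k => (tailSum_sub hc.summable k).symm
  have hsum : ∀ k, HasSum (fun j : ℕ => c (k + j)) (T k) := hasSum_tailSum hc.summable
  have hsym : ∀ k, T k + T (1 - k) = 1 := tailSum_add_tailSum hc heven
  have heven' : ∀ m k : ℤ, c (m - k) = c (k - m) := fun m k => by rw [← heven, neg_sub]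
  unfold detJ
  rcases Nat.even_or_odd n with hn | hn
  · have hn' : ¬ Even (n + 1) := Nat.not_even_iff_odd.2 hn.add_one
    have hr : rr (n + 1) = rr n + 1 := by
      obtain ⟨k, rfl⟩ := hn
      unfold rr
      omega
    have ha : alph n = 1 / 2 := if_pos hn
    have ha' : alph (n + 1) = -(1 / 2) := if_neg hn'
    simp only [ha, ha', innerJ_half_chebJ ψ hψ, innerJ_neg_half_chebJ ψ hψ]
    refine intertwine_det_succ_length hr (fun x k => c (x - k) - c (x + k + 2))
      (fun x k => c (x - k) + c (x + k + 1)) (fun x k => T (k - x) + T (x + k + 1))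
      ?_ ?_ ?_ ?_ m hm l hl
    · intro x k
      rw [heven']
      simp only [hT]
      push_cast
      ring_nf
    · intro x
      have := hsym (-x)
      simpa [add_comm] using this
    · intro x k
      rw [heven']
      simp only [hT]
      push_cast
      ring_nf
    · intro x k
      convert (hsum (k - x)).add (hsum (x + k + 1)) using 3 with y
      · rw [heven']
        push_cast
        ring_nf
      · push_cast
        ring_nf
  · have hn' : ¬ Even n := Nat.not_even_iff_odd.2 hn
    have hr : rr (n + 1) = rr n := by
      obtain ⟨k, rfl⟩ := hn
      unfold rr
      omega
    have ha : alph n = -(1 / 2) := if_neg hn'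
    have ha' : alph (n + 1) = 1 / 2 := if_pos hn.add_one
    simp only [ha, ha', innerJ_half_chebJ ψ hψ, innerJ_neg_half_chebJ ψ hψ]
    refine intertwine_det_same_length hr (fun x k => c (x - k) - c (x + k + 2))
      (fun x k => c (x - k) + c (x + k + 1)) (fun x k => T (k + 1 - x) - T (x + k + 1))
      ?_ ?_ ?_ ?_ m hm l hl
    · intro x k
      rw [heven']
      simp only [hT]
      push_cast
      ring_nf
    · intro k
      simp
    · intro x k
      rw [heven']
      simp only [hT]
      push_cast
      ring_nf
    · intro x k
      have e1 : ∀ y : ℕ, c (x - ((k + y : ℕ) : ℤ)) - c (x + ((k + y : ℕ) : ℤ) + 2) =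
          c (k - x + y) - c (x + k + 2 + y) := by
        intro y
        rw [heven']
        push_cast
        ring_nf
      have e2 : T (k + 1 - ((x + 1 : ℕ) : ℤ)) - T (((x + 1 : ℕ) : ℤ) + k + 1) =
          T (k - x) - T (x + k + 2) := by
        push_cast
        ring_nf
      simp only [e1, e2]
      exact (hsum (k - x)).sub (hsum (x + k + 2))

/-- Intertwining relation between transition and cotransition operators:
`T^{n+1}_n T^ψ_n = T^ψ_{n+1} T^{n+1}_n`, both sums converging (absolutely) to the
same value. -/
theorem intertwining_relation (ψ : ℝ → ℝ) (U : Set ℝ) (hU : IsOpen U)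
    (hsub : Set.Icc (-1 : ℝ) 1 ⊆ U) (hψ : ContDiffOn ℝ (⊤ : ℕ∞) ψ U) (hψ1 : ψ 1 = 1)
    (n : ℕ) (hn : 1 ≤ n)
    (μ : { m : Fin (rr (n + 1)) → ℕ // Antitone m })
    (lam : { l : Fin (rr n) → ℕ // Antitone l }) :
    ∃ S : ℝ,
      HasSum (fun z : { l : Fin (rr n) → ℕ // Antitone l } =>
        coT n μ.1 z.1 * Tpsi ψ n z.1 lam.1) S ∧
      HasSum (fun z : { m : Fin (rr (n + 1)) → ℕ // Antitone m } =>
        Tpsi ψ (n + 1) μ.1 z.1 * coT n z.1 lam.1) S := by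
  obtain ⟨hcont, hc⟩ := hasSum_cosCoeff_of_contDiffOn ψ U hU hsub hψ
  rw [hψ1] at hc
  obtain ⟨S, hS1, hS2⟩ := exists_hasSum_detJ ψ hcont hc n μ.1 μ.2 lam.1 lam.2
  refine ⟨dimSp n lam.1 / dimSp (n + 1) μ.1 * S, ?_, ?_⟩
  · have h : ∀ z : {l : Fin (rr n) → ℕ // Antitone l},
        coT n μ.1 z.1 * Tpsi ψ n z.1 lam.1 = dimSp n lam.1 / dimSp (n + 1) μ.1 *
          ((if interlaceN z.1 μ.1 then 1 else 0) * detJ ψ n z.1 lam.1) := by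
      intro z
      have hz := dimSp_ne_zero n z.1 z.2
      rw [coT, Tpsi, ← detJ]
      field_simp
    simp only [h]
    exact hS1.mul_left _
  · have h : ∀ z : {m : Fin (rr (n + 1)) → ℕ // Antitone m},
        Tpsi ψ (n + 1) μ.1 z.1 * coT n z.1 lam.1 = dimSp n lam.1 / dimSp (n + 1) μ.1 *
          ((if interlaceN lam.1 z.1 then 1 else 0) * detJ ψ (n + 1) μ.1 z.1) := by
      intro z
      have hz := dimSp_ne_zero (n + 1) z.1 z.2
      rw [coT, Tpsi, ← detJ]
      field_simp
    simp only [h]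
    exact hS2.mul_left _
end
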